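/- arXiv:2203.16438 — 3 statements merged into one kernel-verified Lean document; each statement's English description precedes it below -/
import Mathlib

section
/- Nesterov-acceleration Case 2(a) contraction: suppose 0 < β < 1, 0 < γ ≤ β(2−β)/(8+β²), 0 < λ < 1, ζ > 0, and k ≥ ΔT. If ‖ϑ_{k−ΔT} − θ*‖² ≤ λγ V_{k−ΔT} and W₂ ≥ ζ‖θ_{k−ΔT} − ϑ_{k−ΔT}‖, then ‖θ_{k−ΔT} − ϑ_{k−ΔT}‖² ≥ (1−λ)γ V_{k−ΔT} and V_k ≤ [1 − (9/16)·γζ²(1−λ)/ΔT]·V_{k−ΔT}. -/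
open scoped RealInnerProductSpace

theorem gain_le_one_eighth {β γ : ℝ} (hγ : γ ≤ β * (2 - β) / (8 + β ^ 2)) : γ ≤ 1 / 8 := by
  refine hγ.trans ?_
  rw [div_le_div_iff₀ (by positivity) (by norm_num)]
  nlinarith [sq_nonneg (β - 1), sq_nonneg β]

/-- Scalar form of the decrease of the Lyapunov function over one step. -/
theorem lyapunov_scalar_bound {β γ a w r q Z : ℝ} (hβ0 : 0 < β) (hβ1 : β < 1) (hγ0 : 0 < γ)
    (hγ : γ ≤ β * (2 - β) / (8 + β ^ 2)) (ha0 : 0 ≤ a) (ha1 : a ≤ 1)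
    (hq : w + q = r * (1 - γ * β * a)) (hZ : q ^ 2 ≤ Z) :
    -2 * γ * (w ^ 2 - ((1 - β) * q) ^ 2) + 2 * γ ^ 2 * a * (w + (1 - β) * q) ^ 2
      - β * (2 - β) * Z - 2 * γ * β * (r * q) - γ ^ 2 * β ^ 2 * r ^ 2 * a
      ≤ -(9 / 16) * γ * w ^ 2 := by
  have hγ8 := gain_le_one_eighth hγ
  rw [le_div_iff₀ (by positivity)] at hγ
  have hγβ : γ * β ≤ 1 / 8 := by nlinarith
  have hg : γ * β * a ≤ 1 / 8 := by nlinarith [mul_pos hγ0 hβ0]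
  have hrq : -(2 / 7) * w ^ 2 ≤ r * q := by
    have h : (w + q) * q = (r * q) * (1 - γ * β * a) := by rw [hq]; ring
    by_contra! hlt
    nlinarith [sq_nonneg (w + 2 * q), sq_nonneg w]
  have hβrq : -(2 / 7) * w ^ 2 ≤ β * (r * q) := by
    nlinarith [mul_le_mul_of_nonneg_left hrq hβ0.le, mul_nonneg (sub_pos.2 hβ1).le (sq_nonneg w)]
  have hQ : ((1 - β) * q) ^ 2 ≤ q ^ 2 := by
    rw [mul_pow]
    exact mul_le_of_le_one_left (sq_nonneg q) (by nlinarith)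
  have hs : γ * a * (w + (1 - β) * q) ^ 2 ≤ 1 / 4 * (w ^ 2 + q ^ 2) := by
    have h1 : γ * a ≤ 1 / 8 := by nlinarith
    have h2 : (w + (1 - β) * q) ^ 2 ≤ 2 * (w ^ 2 + q ^ 2) := by
      nlinarith [sq_nonneg (w - (1 - β) * q)]
    nlinarith [mul_le_mul_of_nonneg_right h1 (sq_nonneg (w + (1 - β) * q))]
  have hz : γ * (8 * q ^ 2) ≤ β * (2 - β) * Z := by
    have h1 : γ * 8 ≤ β * (2 - β) := by nlinarith [mul_nonneg hγ0.le (sq_nonneg β)]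
    nlinarith [mul_le_mul_of_nonneg_right h1 (sq_nonneg q),
      mul_le_mul_of_nonneg_left hZ (mul_nonneg hβ0.le (by linarith : (0 : ℝ) ≤ 2 - β))]
  have hr : 0 ≤ γ ^ 2 * β ^ 2 * r ^ 2 * a := by positivity
  have hsum : -2 * (w ^ 2 - ((1 - β) * q) ^ 2) + 2 * (γ * a * (w + (1 - β) * q) ^ 2)
      - 8 * q ^ 2 - 2 * (β * (r * q)) ≤ -(9 / 16) * w ^ 2 := by
    nlinarith [sq_nonneg w, sq_nonneg q]
  nlinarith [mul_le_mul_of_nonneg_left hsum hγ0.le]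

/-- Decrease of the Lyapunov function over one step, with `e = ϑ - θ*`, `y = θ - ϑ` and the
normalized regressor `u`. -/
theorem lyapunov_step_normalized {E : Type*} [NormedAddCommGroup E] [InnerProductSpace ℝ E]
    {β γ : ℝ} (hβ0 : 0 < β) (hβ1 : β < 1) (hγ0 : 0 < γ)
    (hγ : γ ≤ β * (2 - β) / (8 + β ^ 2)) {u e y z e' y' : E} (hu : ‖u‖ ≤ 1)
    (hz : z = y - (γ * β * ⟪u, y + e⟫) • u)
    (he' : e' = e - (γ * ⟪u, e + (1 - β) • z⟫) • u)
    (hy' : y' = (1 - β) • z + (γ * ⟪u, e + (1 - β) • z⟫) • u) :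
    ‖e'‖ ^ 2 + ‖y'‖ ^ 2 ≤ ‖e‖ ^ 2 + ‖y‖ ^ 2 - 9 / 16 * γ * ⟪u, e⟫ ^ 2 := by
  have ha1 : ‖u‖ ^ 2 ≤ 1 := pow_le_one₀ (norm_nonneg u) hu
  have hq : ⟪u, z⟫ = ⟪u, y + e⟫ - ⟪u, e⟫ - γ * β * ‖u‖ ^ 2 * ⟪u, y + e⟫ := by
    rw [hz, inner_sub_right, inner_smul_right, real_inner_self_eq_norm_sq, inner_add_right]
    ring
  have hZ : ⟪u, z⟫ ^ 2 ≤ ‖z‖ ^ 2 := by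
    refine sq_le_sq.2 ?_
    rw [abs_norm]
    exact (abs_real_inner_le_norm u z).trans (mul_le_of_le_one_left (norm_nonneg z) hu)
  have hy : ‖y‖ ^ 2 = ‖z‖ ^ 2 + 2 * (γ * β) * (⟪u, y + e⟫ * ⟪u, z⟫)
      + γ ^ 2 * β ^ 2 * ⟪u, y + e⟫ ^ 2 * ‖u‖ ^ 2 := by
    have h : y = z + (γ * β * ⟪u, y + e⟫) • u := by rw [hz]; abel
    generalize ⟪u, y + e⟫ = r at h ⊢
    rw [h, norm_add_sq_real, norm_smul, inner_smul_right, real_inner_comm u z, mul_pow,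
      Real.norm_eq_abs, sq_abs]
    ring
  have hs : ⟪u, e + (1 - β) • z⟫ = ⟪u, e⟫ + (1 - β) * ⟪u, z⟫ := by
    rw [inner_add_right, inner_smul_right]
  have hE : ‖e'‖ ^ 2 = ‖e‖ ^ 2 - 2 * γ * (⟪u, e⟫ + (1 - β) * ⟪u, z⟫) * ⟪u, e⟫
      + γ ^ 2 * (⟪u, e⟫ + (1 - β) * ⟪u, z⟫) ^ 2 * ‖u‖ ^ 2 := by
    rw [he', hs, norm_sub_sq_real, norm_smul, inner_smul_right, real_inner_comm u e, mul_pow,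
      Real.norm_eq_abs, sq_abs]
    ring
  have hY : ‖y'‖ ^ 2 = (1 - β) ^ 2 * ‖z‖ ^ 2
      + 2 * γ * (⟪u, e⟫ + (1 - β) * ⟪u, z⟫) * ((1 - β) * ⟪u, z⟫)
      + γ ^ 2 * (⟪u, e⟫ + (1 - β) * ⟪u, z⟫) ^ 2 * ‖u‖ ^ 2 := by
    rw [hy', hs, norm_add_sq_real, norm_smul, norm_smul, inner_smul_right, inner_smul_left,
      real_inner_comm u z, mul_pow, mul_pow, Real.norm_eq_abs, Real.norm_eq_abs, sq_abs, sq_abs]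
    simp only [conj_trivial]
    ring
  have key := lyapunov_scalar_bound (w := ⟪u, e⟫) (r := ⟪u, y + e⟫) hβ0 hβ1 hγ0 hγ
    (sq_nonneg ‖u‖) ha1 (by rw [hq]; ring) hZ
  rw [hE, hY, hy]
  linarith

/-- Decrease of the Lyapunov function over one step of the tuner. -/
theorem lyapunov_step {E : Type*} [NormedAddCommGroup E] [InnerProductSpace ℝ E]
    {β γ : ℝ} (hβ0 : 0 < β) (hβ1 : β < 1) (hγ0 : 0 < γ)
    (hγ : γ ≤ β * (2 - β) / (8 + β ^ 2)) {θstar φ θ ϑ θbar θ' ϑ' : E}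
    (hθbar : θbar = θ - ((γ * β / (1 + ‖φ‖ ^ 2)) * ⟪φ, θ - θstar⟫) • φ)
    (hθ : θ' = θbar - β • (θbar - ϑ))
    (hϑ : ϑ' = ϑ - ((γ / (1 + ‖φ‖ ^ 2)) * ⟪φ, θ' - θstar⟫) • φ) :
    ‖ϑ' - θstar‖ ^ 2 + ‖θ' - ϑ'‖ ^ 2 ≤ ‖ϑ - θstar‖ ^ 2 + ‖θ - ϑ‖ ^ 2
      - 9 / 16 * γ * ((1 / Real.sqrt (1 + ‖φ‖ ^ 2)) * |⟪φ, ϑ - θstar⟫|) ^ 2 := by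
  have hN : 0 < 1 + ‖φ‖ ^ 2 := by positivity
  set c := 1 / Real.sqrt (1 + ‖φ‖ ^ 2) with hc
  have hc2 : c * c = 1 / (1 + ‖φ‖ ^ 2) := by
    rw [hc, div_mul_div_comm, Real.mul_self_sqrt hN.le, one_mul]
  have hu : ‖c • φ‖ ≤ 1 := by
    refine (sq_le_one_iff₀ (norm_nonneg _)).1 ?_
    rw [norm_smul, mul_pow, Real.norm_eq_abs, sq_abs, sq, hc2, one_div_mul_eq_div,
      div_le_one hN]
    linarith
  have hsmul : ∀ (d : ℝ) (x : E),
      (d / (1 + ‖φ‖ ^ 2) * ⟪φ, x⟫) • φ = (d * ⟪c • φ, x⟫) • (c • φ) := by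
    intro d x
    rw [real_inner_smul_left, smul_smul]
    congr 1
    linear_combination (-d * ⟪φ, x⟫) * hc2
  rw [hsmul] at hθbar hϑ
  have hθ_sub : θ' - θstar = ϑ - θstar + (1 - β) • (θbar - ϑ) := by rw [hθ]; module
  rw [hθ_sub] at hϑ
  have h := lyapunov_step_normalized hβ0 hβ1 hγ0 hγ (u := c • φ) (e := ϑ - θstar) (y := θ - ϑ)
    (z := θbar - ϑ) (e' := ϑ' - θstar) (y' := θ' - ϑ') hu
    (by rw [hθbar, show θ - ϑ + (ϑ - θstar) = θ - θstar by abel]; abel)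
    (by rw [hϑ]; abel)
    (by
      rw [← sub_sub_sub_cancel_right θ' ϑ' θstar, hθ_sub, hϑ]
      abel)
  rwa [real_inner_smul_left, mul_pow, ← sq_abs ⟪φ, _⟫, ← mul_pow] at h


theorem na_case2a
    (n : ℕ) (hn : 1 ≤ n)
    (θstar : EuclideanSpace ℝ (Fin n))
    (φ θ ϑ θbar : ℕ → EuclideanSpace ℝ (Fin n))
    (β γ : ℝ) (hβ0 : 0 < β) (hβ1 : β < 1)
    (hγ0 : 0 < γ) (hγ : γ ≤ β * (2 - β) / (8 + β ^ 2))
    (hθbar : ∀ k, θbar k =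
      θ k - ((γ * β / (1 + ‖φ k‖ ^ 2)) * ⟪φ k, θ k - θstar⟫) • φ k)
    (hθ : ∀ k, θ (k + 1) = θbar k - β • (θbar k - ϑ k))
    (hϑ : ∀ k, ϑ (k + 1) =
      ϑ k - ((γ / (1 + ‖φ k‖ ^ 2)) * ⟪φ k, θ (k + 1) - θstar⟫) • φ k)
    (V : ℕ → ℝ)
    (hV : ∀ k, V k = (1 / γ) * ‖ϑ k - θstar‖ ^ 2 + (1 / γ) * ‖θ k - ϑ k‖ ^ 2)
    (ΔT : ℕ) (hΔT : 1 ≤ ΔT) (k : ℕ) (hk : ΔT ≤ k)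
    (W₁ W₂ : ℝ)
    (hW₁ : W₁ = ∑ i ∈ Finset.Ico (k - ΔT) k, ‖θbar i - ϑ i‖)
    (hW₂ : W₂ = ∑ i ∈ Finset.Ico (k - ΔT) k,
      (1 / Real.sqrt (1 + ‖φ i‖ ^ 2)) * |⟪φ i, ϑ i - θstar⟫|)
    (lam ζ : ℝ) (hlam0 : 0 < lam) (hlam1 : lam < 1) (hζ : 0 < ζ)
    (hsmall : ‖ϑ (k - ΔT) - θstar‖ ^ 2 ≤ lam * γ * V (k - ΔT))
    (hW2 : ζ * ‖θ (k - ΔT) - ϑ (k - ΔT)‖ ≤ W₂) :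
    (1 - lam) * γ * V (k - ΔT) ≤ ‖θ (k - ΔT) - ϑ (k - ΔT)‖ ^ 2 ∧
    V k ≤ (1 - (9 / 16) * γ * ζ ^ 2 * (1 - lam) / (ΔT : ℝ)) * V (k - ΔT) := by
  have hγV : ∀ i, γ * V i = ‖ϑ i - θstar‖ ^ 2 + ‖θ i - ϑ i‖ ^ 2 := by
    intro i
    rw [hV]
    field_simp
  have hfirst : (1 - lam) * γ * V (k - ΔT) ≤ ‖θ (k - ΔT) - ϑ (k - ΔT)‖ ^ 2 := by
    linarith [hγV (k - ΔT)]
  refine ⟨hfirst, ?_⟩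
  set w : ℕ → ℝ := fun i => (1 / Real.sqrt (1 + ‖φ i‖ ^ 2)) * |⟪φ i, ϑ i - θstar⟫|
  have hstep : ∀ i, V (i + 1) ≤ V i - 9 / 16 * w i ^ 2 := by
    intro i
    have h := lyapunov_step hβ0 hβ1 hγ0 hγ (hθbar i) (hθ i) (hϑ i)
    rw [← hγV, ← hγV] at h
    refine le_of_mul_le_mul_left ?_ hγ0
    linarith
  have hsum : ∀ m j, m ≤ j → V j ≤ V m - 9 / 16 * ∑ i ∈ Finset.Ico m j, w i ^ 2 := by
    intro m j hmj
    induction j, hmj using Nat.le_induction with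
    | base => simp
    | succ j hmj ih =>
      rw [Finset.sum_Ico_succ_top hmj]
      linarith [hstep j]
  have hCS : W₂ ^ 2 ≤ (ΔT : ℝ) * ∑ i ∈ Finset.Ico (k - ΔT) k, w i ^ 2 := by
    have h := sq_sum_le_card_mul_sum_sq (s := Finset.Ico (k - ΔT) k) (f := w)
    rwa [Nat.card_Ico, Nat.sub_sub_self hk, ← hW₂] at h
  have hW2_sq : ζ ^ 2 * ((1 - lam) * γ * V (k - ΔT)) ≤ W₂ ^ 2 :=
    calc ζ ^ 2 * ((1 - lam) * γ * V (k - ΔT))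
        ≤ ζ ^ 2 * ‖θ (k - ΔT) - ϑ (k - ΔT)‖ ^ 2 :=
          mul_le_mul_of_nonneg_left hfirst (sq_nonneg ζ)
      _ = (ζ * ‖θ (k - ΔT) - ϑ (k - ΔT)‖) ^ 2 := (mul_pow _ _ _).symm
      _ ≤ W₂ ^ 2 := pow_le_pow_left₀ (by positivity) hW2 2
  have hΔT0 : (0 : ℝ) < ΔT := by exact_mod_cast hΔT
  have hdiv : ζ ^ 2 * ((1 - lam) * γ * V (k - ΔT)) / ΔT ≤
      ∑ i ∈ Finset.Ico (k - ΔT) k, w i ^ 2 :=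
    (div_le_iff₀' hΔT0).2 (hW2_sq.trans hCS)
  calc V k ≤ V (k - ΔT) - 9 / 16 * ∑ i ∈ Finset.Ico (k - ΔT) k, w i ^ 2 :=
        hsum _ _ (Nat.sub_le _ _)
    _ ≤ V (k - ΔT) - 9 / 16 * (ζ ^ 2 * ((1 - lam) * γ * V (k - ΔT)) / ΔT) := by linarith
    _ = (1 - (9 / 16) * γ * ζ ^ 2 * (1 - lam) / (ΔT : ℝ)) * V (k - ΔT) := by ring
end

section
/- Nesterov-acceleration Case 2(b) lower bound on the momentum sum: suppose 0 < β < 1, 0 < γ ≤ β(2−β)/(8+β²), γβ < 1, ζ > 0, and k ≥ ΔT. If W₂ ≤ ζ‖θ_{k−ΔT} − ϑ_{k−ΔT}‖, then W₁ ≥ ξ·‖θ_{k−ΔT} − ϑ_{k−ΔT}‖, where ξ = (ΔT − γζΔT − γβζ(1+ΔT)/(1−γβ)) / (1 + γ(1−β)ΔT + βΔT + γβ(1+ΔT)/(1−γβ)). -/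
open scoped RealInnerProductSpace

open Finset in
/-- If a sequence `d` decreases by at most `A * u i + B * a i` at each step and
`d i ≤ u i + c * (u i + a i)`, then summing over `T` steps bounds `T * d 0`. -/
theorem mul_initial_le_of_decrement_le {d u a : ℕ → ℝ} {A B c : ℝ}
    (hA : 0 ≤ A) (hB : 0 ≤ B) (hu : ∀ i, 0 ≤ u i) (ha : ∀ i, 0 ≤ a i)
    (hd : ∀ i, d i - (A * u i + B * a i) ≤ d (i + 1))
    (hdu : ∀ i, d i ≤ u i + c * (u i + a i)) (T : ℕ) :
    T * d 0 ≤ (1 + c + T * A) * ∑ i ∈ range T, u i + (c + T * B) * ∑ i ∈ range T, a i := by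
  have hlow : ∀ j, d 0 ≤ d j + A * ∑ i ∈ range j, u i + B * ∑ i ∈ range j, a i := by
    intro j
    induction j with
    | zero => simp
    | succ j ih =>
      rw [sum_range_succ, sum_range_succ]
      linarith [hd j]
  have hterm : ∀ j ∈ range T, d 0 ≤ u j + c * (u j + a j)
      + (A * ∑ i ∈ range T, u i + B * ∑ i ∈ range T, a i) := by
    intro j hj
    have hsub : range j ⊆ range T := range_subset_range.2 (mem_range.1 hj).le
    have h₁ := mul_le_mul_of_nonneg_left
      (sum_le_sum_of_subset_of_nonneg hsub fun i _ _ => hu i) hA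
    have h₂ := mul_le_mul_of_nonneg_left
      (sum_le_sum_of_subset_of_nonneg hsub fun i _ _ => ha i) hB
    linarith [hlow j, hdu j]
  have hsum := sum_le_sum hterm
  simp only [sum_add_distrib, ← mul_sum, sum_const, card_range, nsmul_eq_mul] at hsum
  linarith

section InnerProduct

variable {E : Type*} [NormedAddCommGroup E] [InnerProductSpace ℝ E]

theorem norm_inv_sqrt_one_add_sq_smul_le (v : E) :
    ‖(Real.sqrt (1 + ‖v‖ ^ 2))⁻¹ • v‖ ≤ 1 := by
  have hs : 0 < Real.sqrt (1 + ‖v‖ ^ 2) := by positivity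
  rw [norm_smul, norm_inv, Real.norm_of_nonneg hs.le, inv_mul_le_one₀ hs]
  exact Real.le_sqrt_of_sq_le (by linarith)

theorem div_one_add_sq_mul_inner_smul (v x : E) (c : ℝ) :
    ((c / (1 + ‖v‖ ^ 2)) * ⟪v, x⟫) • v =
      (c * ⟪(Real.sqrt (1 + ‖v‖ ^ 2))⁻¹ • v, x⟫) • (Real.sqrt (1 + ‖v‖ ^ 2))⁻¹ • v := by
  have hs : Real.sqrt (1 + ‖v‖ ^ 2) ≠ 0 := by positivity
  have hN : Real.sqrt (1 + ‖v‖ ^ 2) ^ 2 = 1 + ‖v‖ ^ 2 := Real.sq_sqrt (by positivity)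
  rw [real_inner_smul_left, smul_smul]
  congr 1
  field_simp
  rw [hN]
  ring

theorem norm_mul_inner_smul_le {e : E} (he : ‖e‖ ≤ 1) {c : ℝ} (hc : 0 ≤ c) (x : E) :
    ‖(c * ⟪e, x⟫) • e‖ ≤ c * |⟪e, x⟫| := by
  rw [norm_smul, norm_mul, Real.norm_of_nonneg hc, Real.norm_eq_abs]
  exact mul_le_of_le_one_right (by positivity) he

theorem abs_inner_add_le {e : E} (he : ‖e‖ ≤ 1) (x y : E) :
    |⟪e, x + y⟫| ≤ ‖x‖ + |⟪e, y⟫| := by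
  rw [inner_add_right]
  have h : |⟪e, x⟫| ≤ ‖x‖ :=
    (abs_real_inner_le_norm e x).trans (mul_le_of_le_one_left (norm_nonneg x) he)
  exact (abs_add_le _ _).trans (by linarith)

/-- A gradient step of size `c < 1` along `e` moves the point by an amount controlled by the
residual after the step. -/
theorem norm_gradient_step_le {e x y p z : E} (he : ‖e‖ ≤ 1) {c : ℝ} (hc : 0 ≤ c) (hc1 : c < 1)
    (hy : y = x - (c * ⟪e, x - p⟫) • e) :
    ‖x - y‖ ≤ c / (1 - c) * (‖y - z‖ + |⟪e, z - p⟫|) := by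
  have hpos : 0 < 1 - c := by linarith
  have hxy : x - y = (c * ⟪e, x - p⟫) • e := by rw [hy]; abel
  have hstep := norm_mul_inner_smul_le he hc (x - p)
  rw [← hxy] at hstep
  have hsq : ⟪e, e⟫ ≤ 1 := by
    rw [real_inner_self_eq_norm_sq]; exact pow_le_one₀ (norm_nonneg e) he
  have hres : ⟪e, y - p⟫ = (1 - c * ⟪e, e⟫) * ⟪e, x - p⟫ := by
    rw [show y - p = (x - p) - (x - y) by abel, hxy, inner_sub_right, inner_smul_right]
    ring
  have hfac : 1 - c ≤ 1 - c * ⟪e, e⟫ := by nlinarith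
  have hcontr : (1 - c) * |⟪e, x - p⟫| ≤ ‖y - z‖ + |⟪e, z - p⟫| := by
    have h := abs_inner_add_le he (y - z) (z - p)
    rw [sub_add_sub_cancel, hres, abs_mul, abs_of_nonneg (hpos.le.trans hfac)] at h
    exact (mul_le_mul_of_nonneg_right hfac (abs_nonneg _)).trans h
  rw [div_mul_eq_mul_div, le_div_iff₀ hpos]
  nlinarith [mul_le_mul_of_nonneg_left hcontr hc, mul_le_mul_of_nonneg_right hstep hpos.le]

/-- One step of the momentum update changes `θbar - ϑ` into `θ' - ϑ'` with a controlled error. -/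
theorem norm_momentum_step_le {e θbar ϑ θ' ϑ' p : E} (he : ‖e‖ ≤ 1) {β γ : ℝ}
    (hβ : 0 ≤ β) (hβ1 : β ≤ 1) (hγ : 0 ≤ γ)
    (hθ : θ' = θbar - β • (θbar - ϑ)) (hϑ : ϑ' = ϑ - (γ * ⟪e, θ' - p⟫) • e) :
    ‖(θ' - ϑ') - (θbar - ϑ)‖ ≤
      (β + γ * (1 - β)) * ‖θbar - ϑ‖ + γ * |⟪e, ϑ - p⟫| := by
  have hdiff : (θ' - ϑ') - (θbar - ϑ) = (γ * ⟪e, θ' - p⟫) • e - β • (θbar - ϑ) := by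
    rw [hϑ]
    nth_rewrite 1 [hθ]
    abel
  have hsplit : θ' - p = (1 - β) • (θbar - ϑ) + (ϑ - p) := by
    rw [hθ]; module
  have hin := abs_inner_add_le he ((1 - β) • (θbar - ϑ)) (ϑ - p)
  rw [← hsplit, norm_smul, Real.norm_of_nonneg (sub_nonneg.2 hβ1)] at hin
  have hstep := norm_mul_inner_smul_le he hγ (θ' - p)
  have htri := norm_sub_le ((γ * ⟪e, θ' - p⟫) • e) (β • (θbar - ϑ))
  rw [norm_smul β, Real.norm_of_nonneg hβ] at htri
  rw [hdiff]
  linarith [mul_le_mul_of_nonneg_left hin hγ]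

end InnerProduct

theorem na_case2b_momentum_bound
    (n : ℕ) (hn : 1 ≤ n)
    (θstar : EuclideanSpace ℝ (Fin n))
    (φ θ ϑ θbar : ℕ → EuclideanSpace ℝ (Fin n))
    (β γ : ℝ) (hβ0 : 0 < β) (hβ1 : β < 1)
    (hγ0 : 0 < γ) (hγ : γ ≤ β * (2 - β) / (8 + β ^ 2))
    (hθbar : ∀ k, θbar k =
      θ k - ((γ * β / (1 + ‖φ k‖ ^ 2)) * ⟪φ k, θ k - θstar⟫) • φ k)
    (hθ : ∀ k, θ (k + 1) = θbar k - β • (θbar k - ϑ k))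
    (hϑ : ∀ k, ϑ (k + 1) =
      ϑ k - ((γ / (1 + ‖φ k‖ ^ 2)) * ⟪φ k, θ (k + 1) - θstar⟫) • φ k)
    (ΔT : ℕ) (hΔT : 1 ≤ ΔT) (k : ℕ) (hk : ΔT ≤ k)
    (W₁ W₂ : ℝ)
    (hW₁ : W₁ = ∑ i ∈ Finset.Ico (k - ΔT) k, ‖θbar i - ϑ i‖)
    (hW₂ : W₂ = ∑ i ∈ Finset.Ico (k - ΔT) k,
      (1 / Real.sqrt (1 + ‖φ i‖ ^ 2)) * |⟪φ i, ϑ i - θstar⟫|)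
    (hγβ : γ * β < 1)
    (ζ : ℝ) (hζ : 0 < ζ)
    (hW2 : W₂ ≤ ζ * ‖θ (k - ΔT) - ϑ (k - ΔT)‖) :
    (((ΔT : ℝ) - γ * ζ * ΔT - γ * β * ζ * (1 + ΔT) / (1 - γ * β)) /
      (1 + γ * (1 - β) * ΔT + β * ΔT + γ * β * (1 + ΔT) / (1 - γ * β))) *
      ‖θ (k - ΔT) - ϑ (k - ΔT)‖ ≤ W₁ := by
  obtain ⟨m, rfl⟩ := Nat.exists_eq_add_of_le' hk
  rw [Nat.add_sub_cancel] at *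
  rw [Finset.sum_Ico_eq_sum_range, Nat.add_sub_cancel_left] at hW₁ hW₂
  have hγβ0 : 0 < γ * β := mul_pos hγ0 hβ0
  have hpos : 0 < 1 - γ * β := by linarith
  set c := γ * β / (1 - γ * β) with hc
  have hc0 : 0 < c := div_pos hγβ0 hpos
  have hγ1β : 0 ≤ γ * (1 - β) := mul_nonneg hγ0.le (by linarith)
  set e : ℕ → EuclideanSpace ℝ (Fin n) :=
    fun i => (Real.sqrt (1 + ‖φ i‖ ^ 2))⁻¹ • φ i with he
  have he1 : ∀ i, ‖e i‖ ≤ 1 := fun i => norm_inv_sqrt_one_add_sq_smul_le (φ i)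
  have ha : ∀ i, (1 / Real.sqrt (1 + ‖φ i‖ ^ 2)) * |⟪φ i, ϑ i - θstar⟫| =
      |⟪e i, ϑ i - θstar⟫| := by
    intro i
    rw [he, real_inner_smul_left, abs_mul, one_div, abs_of_nonneg (inv_nonneg.2 (Real.sqrt_nonneg _))]
  simp only [ha] at hW₂
  have hgrad : ∀ i, ‖θ i - θbar i‖ ≤ c * (‖θbar i - ϑ i‖ + |⟪e i, ϑ i - θstar⟫|) := fun i =>
    norm_gradient_step_le (he1 i) hγβ0.le hγβ
      ((hθbar i).trans (by rw [div_one_add_sq_mul_inner_smul]))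
  have hmom : ∀ i, ‖(θ (i + 1) - ϑ (i + 1)) - (θbar i - ϑ i)‖ ≤
      (β + γ * (1 - β)) * ‖θbar i - ϑ i‖ + γ * |⟪e i, ϑ i - θstar⟫| := fun i =>
    norm_momentum_step_le (he1 i) hβ0.le hβ1.le hγ0.le (hθ i)
      ((hϑ i).trans (by rw [div_one_add_sq_mul_inner_smul]))
  have hdu : ∀ i, ‖(θ i - ϑ i) - (θbar i - ϑ i)‖ ≤
      c * (‖θbar i - ϑ i‖ + |⟪e i, ϑ i - θstar⟫|) := by
    intro i
    rw [sub_sub_sub_cancel_right]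
    exact hgrad i
  have hkey := mul_initial_le_of_decrement_le
    (d := fun i => ‖θ (m + i) - ϑ (m + i)‖) (u := fun i => ‖θbar (m + i) - ϑ (m + i)‖)
    (a := fun i => |⟪e (m + i), ϑ (m + i) - θstar⟫|)
    (A := β + γ * (1 - β) + c) (B := γ + c) (c := c)
    (by positivity) (by positivity) (fun _ => norm_nonneg _) (fun _ => abs_nonneg _)
    (fun i => by
      have h₁ := hmom (m + i)
      have h₂ := hdu (m + i)
      have h₃ := norm_sub_le_norm_sub_add_norm_sub (θ (m + i) - ϑ (m + i))
        (θbar (m + i) - ϑ (m + i)) (θ (m + i + 1) - ϑ (m + i + 1))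
      rw [norm_sub_rev (θbar (m + i) - ϑ (m + i))] at h₃
      have h₄ := norm_sub_norm_le (θ (m + i) - ϑ (m + i)) (θ (m + i + 1) - ϑ (m + i + 1))
      rw [← add_assoc]
      linarith)
    (fun i => by
      have h₂ := hdu (m + i)
      have h₄ := norm_sub_norm_le (θ (m + i) - ϑ (m + i)) (θbar (m + i) - ϑ (m + i))
      linarith) ΔT
  simp only [add_zero] at hkey
  rw [← hW₁, ← hW₂] at hkey
  have hT : (0 : ℝ) ≤ ΔT := Nat.cast_nonneg _
  have hW2' := mul_le_mul_of_nonneg_left hW2 (by positivity : 0 ≤ c + ΔT * (γ + c))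
  have hnum : γ * β * ζ * (1 + ΔT) / (1 - γ * β) = c * ζ * (1 + ΔT) := by rw [hc]; ring
  have hden : γ * β * (1 + ΔT) / (1 - γ * β) = c * (1 + ΔT) := by rw [hc]; ring
  rw [hnum, hden, div_mul_eq_mul_div, div_le_iff₀ (by positivity)]
  linarith
end

section
/- Theorem 2(ii) (exponential convergence of the Nesterov-acceleration tuner): suppose 0 < β < 1, 0 < γ ≤ β(2−β)/(8+β²), the regressor is PE with level ε over window ΔT, ‖φ_k‖ ≤ Φ for all k, 0 < λ < 1, η > 0 satisfies γη(1−β) < ε₂ with ε₂ = ε/√(1+Φ²), and ζ > 0 is such that ξ = (ΔT − γζΔT − γβζ(1+ΔT)/(1−γβ)) / (1 + γ(1−β)ΔT + βΔT + γβ(1+ΔT)/(1−γβ)) > 0 (which also requires γβ < 1). Let μ = min{μ₁, μ₂, μ₃, μ₄} where μ₁ = (7/4)λγη²/ΔT, μ₂ = (9/16)·ΔT·(ε₂ − γη(1−β))²·λγ/(1+γΔT)², μ₃ = (9/16)γζ²(1−λ)/ΔT, μ₄ = (7/4)ξ²(1−λ)γ/ΔT. Then for every k ≥ 0, V_k ≤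 exp(−μ·⌊k/ΔT⌋)·V_0. -/
open scoped RealInnerProductSpace

section ErrorDynamics

variable {E : Type*} [NormedAddCommGroup E] [InnerProductSpace ℝ E]

/-- The scalar inequality behind the one-step decrease of the Lyapunov function. Here `r` plays the
role of `‖a‖ ^ 2`, `q` of `⟪a, z⟫` and `Z` of `‖z‖`. -/
lemma scalar_decrease {β γ r u q s Z : ℝ} (hβ0 : 0 < β) (hβ1 : β < 1) (hγ0 : 0 < γ)
    (hγ : γ * (8 + β ^ 2) ≤ β * (2 - β)) (hr0 : 0 ≤ r) (hr1 : r ≤ 1) (hq : q ^ 2 ≤ Z ^ 2)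
    (hs : s * (1 - γ * β * r) = u + q) :
    -2 * u * (u + (1 - β) * q) + 2 * (1 - β) * (u + (1 - β) * q) * q
      + 2 * γ * r * (u + (1 - β) * q) ^ 2 + (9 / 16 * u ^ 2 + 7 / 4 * Z ^ 2)
      ≤ (8 + β ^ 2) * Z ^ 2 + 2 * β * (s * q) := by
  have hγ8 : γ ≤ 1 / 8 := by nlinarith [sq_nonneg (1 - β), mul_pos hγ0 (sq_pos_of_pos hβ0)]
  have hγβr : γ * β * r ≤ 1 / 8 := by nlinarith [mul_pos hγ0 hβ0]
  have hD : 7 / 8 ≤ 1 - γ * β * r := by linarith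
  have hγr : γ * r ≤ 1 / 8 := by nlinarith
  have hβsq1 : (1 - β) ^ 2 ≤ 1 := pow_le_one₀ (by linarith) (by linarith)
  have hp : (u + (1 - β) * q) ^ 2 ≤ 2 * u ^ 2 + 2 * q ^ 2 := by
    have : ((1 - β) * q) ^ 2 ≤ q ^ 2 := by
      rw [mul_pow]
      exact mul_le_of_le_one_left (sq_nonneg q) hβsq1
    nlinarith [sq_nonneg (u - (1 - β) * q)]
  have hp' : γ * r * (u + (1 - β) * q) ^ 2 ≤ 1 / 8 * (2 * u ^ 2 + 2 * q ^ 2) :=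
    mul_le_mul hγr hp (sq_nonneg _) (by norm_num)
  have hsq : -(8 / 7 * (|u| * |q|)) ≤ s * q := by
    have h1 : (s * q) * (1 - γ * β * r) = u * q + q ^ 2 := by
      linear_combination q * hs
    have h2 : -(|u| * |q|) ≤ u * q := by rw [← abs_mul]; exact neg_abs_le _
    by_contra! h
    nlinarith [sq_nonneg q, mul_nonneg (abs_nonneg u) (abs_nonneg q)]
  have hβsq : -(8 / 7 * (|u| * |q|)) ≤ β * (s * q) := by
    nlinarith [mul_nonneg (abs_nonneg u) (abs_nonneg q)]
  have hq2 : (1 - β) ^ 2 * q ^ 2 ≤ q ^ 2 :=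
    mul_le_of_le_one_left (sq_nonneg q) hβsq1
  nlinarith [sq_nonneg (|u| - 2 * |q|), sq_abs u, sq_abs q, sq_nonneg u, sq_nonneg q]

/-- One-step decrease of `‖x‖ ^ 2 + ‖y‖ ^ 2`. -/
lemma norm_sq_decrease {β γ s p : ℝ} {a x y z : E} (hβ0 : 0 < β) (hβ1 : β < 1) (hγ0 : 0 < γ)
    (hγ : γ * (8 + β ^ 2) ≤ β * (2 - β)) (ha : ‖a‖ ≤ 1) (hs : s = ⟪a, x + y⟫)
    (hz : z = y - (γ * β * s) • a) (hp : p = ⟪a, x⟫ + (1 - β) * ⟪a, z⟫) :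
    ‖x - (γ * p) • a‖ ^ 2 + ‖(1 - β) • z + (γ * p) • a‖ ^ 2
      + γ * (9 / 16 * ⟪a, x⟫ ^ 2 + 7 / 4 * ‖z‖ ^ 2) ≤ ‖x‖ ^ 2 + ‖y‖ ^ 2 := by
  have hy : y = z + (γ * β * s) • a := by rw [hz]; abel
  have hs' : s * (1 - γ * β * ‖a‖ ^ 2) = ⟪a, x⟫ + ⟪a, z⟫ := by
    rw [hz, inner_sub_right, inner_smul_right, real_inner_self_eq_norm_sq]
    rw [inner_add_right] at hs
    linear_combination hs
  have hq : ⟪a, z⟫ ^ 2 ≤ ‖z‖ ^ 2 := by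
    rw [← sq_abs]
    have := (abs_real_inner_le_norm a z).trans
      (mul_le_of_le_one_left (norm_nonneg z) ha)
    gcongr
  have key := scalar_decrease hβ0 hβ1 hγ0 hγ (sq_nonneg ‖a‖)
    (pow_le_one₀ (norm_nonneg a) ha) hq hs'
  rw [← hp] at key
  have e1 : ‖x - (γ * p) • a‖ ^ 2 = ‖x‖ ^ 2 - 2 * γ * p * ⟪a, x⟫ + γ ^ 2 * p ^ 2 * ‖a‖ ^ 2 := by
    rw [norm_sub_sq_real, inner_smul_right, norm_smul, mul_pow, Real.norm_eq_abs, sq_abs,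
      real_inner_comm]
    ring
  have e2 : ‖(1 - β) • z + (γ * p) • a‖ ^ 2 =
      (1 - β) ^ 2 * ‖z‖ ^ 2 + 2 * (1 - β) * γ * p * ⟪a, z⟫ + γ ^ 2 * p ^ 2 * ‖a‖ ^ 2 := by
    rw [norm_add_sq_real, inner_smul_right, inner_smul_left, norm_smul, norm_smul, mul_pow,
      mul_pow, Real.norm_eq_abs, Real.norm_eq_abs, sq_abs, sq_abs, real_inner_comm]
    simp only [conj_trivial]
    ring
  have e3 : ‖y‖ ^ 2 =
      ‖z‖ ^ 2 + 2 * γ * β * (s * ⟪a, z⟫) + γ ^ 2 * β ^ 2 * s ^ 2 * ‖a‖ ^ 2 := by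
    rw [hy, norm_add_sq_real, inner_smul_right, norm_smul, mul_pow, Real.norm_eq_abs, sq_abs,
      real_inner_comm]
    ring
  have hdrop : 0 ≤ γ ^ 2 * β ^ 2 * s ^ 2 * ‖a‖ ^ 2 := by positivity
  have h8 := mul_le_mul_of_nonneg_right hγ (sq_nonneg ‖z‖)
  have hk := mul_le_mul_of_nonneg_left key hγ0.le
  rw [e1, e2, e3]
  linarith

/-- The parameter error `x = ϑ - θ*`, the mismatch `y = θ - ϑ` and its corrected value `z = θbar - ϑ`
of the tuner, driven by the normalized regressor `a`. -/
structure IsTunerError (β γ : ℝ) (a x y z : ℕ → E) : Prop where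
  norm_le_one : ∀ k, ‖a k‖ ≤ 1
  corrected : ∀ k, z k = y k - (γ * β * ⟪a k, x k + y k⟫) • a k
  succ_left : ∀ k, x (k + 1) = x k - (γ * (⟪a k, x k⟫ + (1 - β) * ⟪a k, z k⟫)) • a k
  succ_right : ∀ k,
    y (k + 1) = (1 - β) • z k + (γ * (⟪a k, x k⟫ + (1 - β) * ⟪a k, z k⟫)) • a k

namespace IsTunerError

variable {β γ : ℝ} {a x y z : ℕ → E}

lemma shift (h : IsTunerError β γ a x y z) (m : ℕ) :
    IsTunerError β γ (fun k => a (m + k)) (fun k => x (m + k)) (fun k => y (m + k))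
      (fun k => z (m + k)) where
  norm_le_one k := h.norm_le_one (m + k)
  corrected k := h.corrected (m + k)
  succ_left k := h.succ_left (m + k)
  succ_right k := h.succ_right (m + k)

lemma sum_decrease (h : IsTunerError β γ a x y z) (hβ0 : 0 < β) (hβ1 : β < 1) (hγ0 : 0 < γ)
    (hγ : γ * (8 + β ^ 2) ≤ β * (2 - β)) (T : ℕ) :
    ‖x T‖ ^ 2 + ‖y T‖ ^ 2 + γ * (9 / 16 * ∑ i ∈ Finset.range T, |⟪a i, x i⟫| ^ 2
      + 7 / 4 * ∑ i ∈ Finset.range T, ‖z i‖ ^ 2) ≤ ‖x 0‖ ^ 2 + ‖y 0‖ ^ 2 := by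
  induction T with
  | zero => simp
  | succ T ih =>
    have := norm_sq_decrease hβ0 hβ1 hγ0 hγ (h.norm_le_one T) rfl (h.corrected T) rfl
    rw [← h.succ_left, ← h.succ_right, ← sq_abs ⟪a T, x T⟫] at this
    rw [Finset.sum_range_succ, Finset.sum_range_succ]
    linarith

lemma abs_inner_le (h : IsTunerError β γ a x y z) (k : ℕ) (w : E) : |⟪a k, w⟫| ≤ ‖w‖ :=
  (abs_real_inner_le_norm _ _).trans (mul_le_of_le_one_left (norm_nonneg w) (h.norm_le_one k))

lemma norm_smul_le (h : IsTunerError β γ a x y z) (k : ℕ) (c : ℝ) : ‖c • a k‖ ≤ |c| := by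
  rw [norm_smul, Real.norm_eq_abs]
  exact mul_le_of_le_one_right (abs_nonneg c) (h.norm_le_one k)

lemma gain_le (h : IsTunerError β γ a x y z) (hβ1 : β < 1) (hγ0 : 0 < γ) (k : ℕ) :
    |γ * (⟪a k, x k⟫ + (1 - β) * ⟪a k, z k⟫)| ≤
      γ * |⟪a k, x k⟫| + γ * (1 - β) * ‖z k‖ := by
  rw [abs_mul, abs_of_pos hγ0, mul_assoc, ← mul_add]
  gcongr
  refine (abs_add_le _ _).trans ?_
  rw [abs_mul, abs_of_pos (sub_pos.2 hβ1)]
  have := sub_pos.2 hβ1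
  gcongr
  exact h.abs_inner_le k _

lemma norm_sub_zero_left_le (h : IsTunerError β γ a x y z) (hβ1 : β < 1) (hγ0 : 0 < γ) (k : ℕ) :
    ‖x k - x 0‖ ≤ ∑ i ∈ Finset.range k, (γ * |⟪a i, x i⟫| + γ * (1 - β) * ‖z i‖) := by
  rw [← Finset.sum_range_sub]
  refine norm_sum_le_of_le _ fun i _ => ?_
  rw [h.succ_left, sub_sub_cancel_left, norm_neg]
  exact (h.norm_smul_le _ _).trans (h.gain_le hβ1 hγ0 i)

lemma corrector_le (h : IsTunerError β γ a x y z) (hβ0 : 0 < β) (hγ0 : 0 < γ)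
    (hγβ : γ * β < 1) (k : ℕ) :
    |γ * β * ⟪a k, x k + y k⟫| ≤ γ * β / (1 - γ * β) * (|⟪a k, x k⟫| + ‖z k‖) := by
  have hpos : 0 < γ * β := mul_pos hγ0 hβ0
  have hs : ⟪a k, x k + y k⟫ =
      ⟪a k, x k⟫ + ⟪a k, z k⟫ + γ * β * ⟪a k, x k + y k⟫ * ‖a k‖ ^ 2 := by
    conv_rhs => rw [h.corrected k, inner_sub_right, inner_smul_right, real_inner_self_eq_norm_sq]
    rw [inner_add_right]
    ring
  have hle : |⟪a k, x k + y k⟫| ≤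
      |⟪a k, x k⟫| + ‖z k‖ + γ * β * |⟪a k, x k + y k⟫| := by
    have h1 := abs_add_three ⟪a k, x k⟫ ⟪a k, z k⟫ (γ * β * ⟪a k, x k + y k⟫ * ‖a k‖ ^ 2)
    rw [← hs, abs_mul, abs_mul, abs_of_pos hpos, abs_of_nonneg (sq_nonneg ‖a k‖)] at h1
    have h2 := h.abs_inner_le k (z k)
    have h3 : γ * β * |⟪a k, x k + y k⟫| * ‖a k‖ ^ 2 ≤ γ * β * |⟪a k, x k + y k⟫| :=
      mul_le_of_le_one_right (by positivity) (pow_le_one₀ (norm_nonneg _) (h.norm_le_one k))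
    linarith
  rw [abs_mul, abs_of_pos hpos, div_mul_eq_mul_div, mul_div_assoc]
  refine mul_le_mul_of_nonneg_left ?_ hpos.le
  rw [le_div_iff₀ (sub_pos.2 hγβ)]
  linarith

lemma norm_sub_zero_right_le (h : IsTunerError β γ a x y z) (hβ0 : 0 < β) (hβ1 : β < 1)
    (hγ0 : 0 < γ) (hγβ : γ * β < 1) (k : ℕ) :
    ‖y k - y 0‖ ≤ ∑ i ∈ Finset.range k, (β * ‖z i‖
      + γ * β / (1 - γ * β) * (|⟪a i, x i⟫| + ‖z i‖)
      + (γ * |⟪a i, x i⟫| + γ * (1 - β) * ‖z i‖)) := by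
  rw [← Finset.sum_range_sub]
  refine norm_sum_le_of_le _ fun i _ => ?_
  have e : y (i + 1) - y i = -(β • z i) + -((γ * β * ⟪a i, x i + y i⟫) • a i)
      + (γ * (⟪a i, x i⟫ + (1 - β) * ⟪a i, z i⟫)) • a i := by
    have hy : y i = z i + (γ * β * ⟪a i, x i + y i⟫) • a i := by
      conv_rhs => enter [1]; rw [h.corrected i]
      abel
    rw [h.succ_right]
    conv_lhs => enter [2]; rw [hy]
    module
  rw [e]
  refine norm_add₃_le.trans ?_
  rw [norm_neg, norm_neg, norm_smul, Real.norm_eq_abs, abs_of_pos hβ0]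
  gcongr
  · exact (h.norm_smul_le _ _).trans (h.corrector_le hβ0 hγ0 hγβ i)
  · exact (h.norm_smul_le _ _).trans (h.gain_le hβ1 hγ0 i)

/-- Excitation of the initial parameter error forces the error signals `⟪a, x⟫` and `z` to be
visible over the window. -/
lemma excitation_left_le (h : IsTunerError β γ a x y z) (hβ1 : β < 1) (hγ0 : 0 < γ) (T : ℕ) :
    ∑ i ∈ Finset.range T, |⟪a i, x 0⟫| ≤ (1 + γ * T) * ∑ i ∈ Finset.range T, |⟪a i, x i⟫|
      + γ * (1 - β) * T * ∑ i ∈ Finset.range T, ‖z i‖ := by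
  have hβ' := sub_pos.2 hβ1
  have key : ∀ i ∈ Finset.range T, |⟪a i, x 0⟫| ≤ |⟪a i, x i⟫| +
      ∑ j ∈ Finset.range T, (γ * |⟪a j, x j⟫| + γ * (1 - β) * ‖z j‖) := by
    intro i hi
    have h1 : ⟪a i, x 0⟫ = ⟪a i, x i⟫ - ⟪a i, x i - x 0⟫ := by rw [inner_sub_right]; ring
    rw [h1]
    refine (abs_sub _ _).trans (add_le_add le_rfl ?_)
    refine (h.abs_inner_le i _).trans ((h.norm_sub_zero_left_le hβ1 hγ0 i).trans ?_)
    exact Finset.sum_le_sum_of_subset_of_nonneg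
      (Finset.range_subset_range.2 (Finset.mem_range.1 hi).le) fun j _ _ => by positivity
  refine (Finset.sum_le_sum key).trans (le_of_eq ?_)
  rw [Finset.sum_add_distrib, Finset.sum_const, Finset.card_range, nsmul_eq_mul,
    Finset.sum_add_distrib, ← Finset.mul_sum, ← Finset.mul_sum]
  ring

/-- A nonzero initial mismatch forces the error signals `⟪a, x⟫` and `z` to be visible over the
window. -/
lemma excitation_right_le (h : IsTunerError β γ a x y z) (hβ0 : 0 < β) (hβ1 : β < 1)
    (hγ0 : 0 < γ) (hγβ : γ * β < 1) (T : ℕ) :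
    T * ‖y 0‖ ≤ (1 + γ * (1 - β) * T + β * T + γ * β * (1 + T) / (1 - γ * β)) *
        ∑ i ∈ Finset.range T, ‖z i‖
      + (γ * T + γ * β * (1 + T) / (1 - γ * β)) * ∑ i ∈ Finset.range T, |⟪a i, x i⟫| := by
  have hβ' := sub_pos.2 hβ1
  have hc : 0 < 1 - γ * β := sub_pos.2 hγβ
  have key : ∀ i ∈ Finset.range T, ‖y 0‖ ≤ ‖z i‖ +
      γ * β / (1 - γ * β) * (|⟪a i, x i⟫| + ‖z i‖) +
      ∑ j ∈ Finset.range T, (β * ‖z j‖ + γ * β / (1 - γ * β) * (|⟪a j, x j⟫| + ‖z j‖)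
        + (γ * |⟪a j, x j⟫| + γ * (1 - β) * ‖z j‖)) := by
    intro i hi
    have h1 : y 0 = z i + (γ * β * ⟪a i, x i + y i⟫) • a i + -(y i - y 0) := by
      conv_rhs => enter [1, 1]; rw [h.corrected i]
      abel
    rw [h1]
    refine norm_add₃_le.trans ?_
    rw [norm_neg]
    gcongr ?_ + ?_ + ?_
    · exact le_rfl
    · exact (h.norm_smul_le _ _).trans (h.corrector_le hβ0 hγ0 hγβ i)
    · refine (h.norm_sub_zero_right_le hβ0 hβ1 hγ0 hγβ i).trans ?_
      exact Finset.sum_le_sum_of_subset_of_nonneg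
        (Finset.range_subset_range.2 (Finset.mem_range.1 hi).le) fun j _ _ => by positivity
  have hsum := Finset.sum_le_sum key
  simp only [Finset.sum_const, Finset.card_range, nsmul_eq_mul, Finset.sum_add_distrib,
    ← Finset.mul_sum] at hsum
  refine hsum.trans (le_of_eq ?_)
  ring

lemma mul_sq_le_of_le_sum {c W : ℝ} (hc : 0 ≤ c) (hW : 0 ≤ W) {T : ℕ} (hT : 1 ≤ T) {f : ℕ → ℝ}
    (hf : c * W ≤ ∑ i ∈ Finset.range T, f i) :
    c ^ 2 * W ^ 2 / T ≤ ∑ i ∈ Finset.range T, f i ^ 2 := by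
  have hT' : (0 : ℝ) < T := by exact_mod_cast hT
  rw [div_le_iff₀ hT', ← mul_pow, mul_comm _ (T : ℝ)]
  refine (pow_le_pow_left₀ (mul_nonneg hc hW) hf 2).trans ?_
  simpa using sq_sum_le_card_mul_sum_sq (s := Finset.range T) (f := f)

/-- Contraction of `‖x‖ ^ 2 + ‖y‖ ^ 2` over one window of persistent excitation. -/
lemma window_contraction (h : IsTunerError β γ a x y z) (hβ0 : 0 < β) (hβ1 : β < 1)
    (hγ0 : 0 < γ) (hγ : γ * (8 + β ^ 2) ≤ β * (2 - β)) (hγβ : γ * β < 1) {T : ℕ} (hT : 1 ≤ T)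
    {e lam η ζ ξ μ : ℝ}
    (hPE : T * e * ‖x 0‖ ≤ ∑ i ∈ Finset.range T, |⟪a i, x 0⟫|)
    (hlam0 : 0 < lam) (hlam1 : lam < 1) (hη : 0 < η) (hζ : 0 < ζ) (hηe : γ * η * (1 - β) < e)
    (hξdef : ξ = ((T : ℝ) - γ * ζ * T - γ * β * ζ * (1 + T) / (1 - γ * β)) /
      (1 + γ * (1 - β) * T + β * T + γ * β * (1 + T) / (1 - γ * β)))
    (hξ : 0 < ξ)
    (hμ₁ : μ ≤ (7 / 4) * lam * γ * η ^ 2 / T)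
    (hμ₂ : μ ≤ (9 / 16) * T * (e - γ * η * (1 - β)) ^ 2 * lam * γ / (1 + γ * T) ^ 2)
    (hμ₃ : μ ≤ (9 / 16) * γ * ζ ^ 2 * (1 - lam) / T)
    (hμ₄ : μ ≤ (7 / 4) * ξ ^ 2 * (1 - lam) * γ / T) :
    ‖x T‖ ^ 2 + ‖y T‖ ^ 2 ≤ (1 - μ) * (‖x 0‖ ^ 2 + ‖y 0‖ ^ 2) := by
  have hT' : (0 : ℝ) < T := by exact_mod_cast hT
  have hβ' := sub_pos.2 hβ1
  have hc : 0 < 1 - γ * β := sub_pos.2 hγβ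
  have hdec := h.sum_decrease hβ0 hβ1 hγ0 hγ T
  have hU0 : 0 ≤ ∑ i ∈ Finset.range T, |⟪a i, x i⟫| ^ 2 := by positivity
  have hZ0 : 0 ≤ ∑ i ∈ Finset.range T, ‖z i‖ ^ 2 := by positivity
  have hl' := sub_pos.2 hlam1
  suffices hsuff : μ * (‖x 0‖ ^ 2 + ‖y 0‖ ^ 2) ≤ γ * (9 / 16 *
      ∑ i ∈ Finset.range T, |⟪a i, x i⟫| ^ 2 + 7 / 4 * ∑ i ∈ Finset.range T, ‖z i‖ ^ 2) by
    linarith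
  rcases le_total (lam * (‖x 0‖ ^ 2 + ‖y 0‖ ^ 2)) (‖x 0‖ ^ 2) with hx | hx
  · rcases le_total (η * ‖x 0‖) (∑ i ∈ Finset.range T, ‖z i‖) with hz | hz
    · have hs := mul_sq_le_of_le_sum hη.le (norm_nonneg _) hT hz
      calc μ * (‖x 0‖ ^ 2 + ‖y 0‖ ^ 2)
          ≤ (7 / 4) * lam * γ * η ^ 2 / T * (‖x 0‖ ^ 2 + ‖y 0‖ ^ 2) := by gcongr
        _ = γ * (7 / 4 * (η ^ 2 * (lam * (‖x 0‖ ^ 2 + ‖y 0‖ ^ 2)) / T)) := by ring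
        _ ≤ γ * (7 / 4 * (η ^ 2 * ‖x 0‖ ^ 2 / T)) := by gcongr
        _ ≤ γ * (9 / 16 * ∑ i ∈ Finset.range T, |⟪a i, x i⟫| ^ 2
            + 7 / 4 * ∑ i ∈ Finset.range T, ‖z i‖ ^ 2) := by gcongr; linarith
    · have he := sub_pos.2 hηe
      have hu : T * (e - γ * η * (1 - β)) / (1 + γ * T) * ‖x 0‖ ≤
          ∑ i ∈ Finset.range T, |⟪a i, x i⟫| := by
        have h1 := h.excitation_left_le hβ1 hγ0 T
        have h2 : γ * (1 - β) * T * ∑ i ∈ Finset.range T, ‖z i‖ ≤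
            γ * (1 - β) * T * (η * ‖x 0‖) := by gcongr
        rw [div_mul_eq_mul_div, div_le_iff₀ (by positivity)]
        linarith
      have hs := mul_sq_le_of_le_sum (by positivity) (norm_nonneg _) hT hu
      calc μ * (‖x 0‖ ^ 2 + ‖y 0‖ ^ 2)
          ≤ (9 / 16) * T * (e - γ * η * (1 - β)) ^ 2 * lam * γ / (1 + γ * T) ^ 2 *
            (‖x 0‖ ^ 2 + ‖y 0‖ ^ 2) := by gcongr
        _ = γ * (9 / 16 * ((T * (e - γ * η * (1 - β)) / (1 + γ * T)) ^ 2 *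
            (lam * (‖x 0‖ ^ 2 + ‖y 0‖ ^ 2)) / T)) := by field_simp
        _ ≤ γ * (9 / 16 * ((T * (e - γ * η * (1 - β)) / (1 + γ * T)) ^ 2 *
            ‖x 0‖ ^ 2 / T)) := by gcongr
        _ ≤ γ * (9 / 16 * ∑ i ∈ Finset.range T, |⟪a i, x i⟫| ^ 2
            + 7 / 4 * ∑ i ∈ Finset.range T, ‖z i‖ ^ 2) := by gcongr; linarith
  · have hy : (1 - lam) * (‖x 0‖ ^ 2 + ‖y 0‖ ^ 2) ≤ ‖y 0‖ ^ 2 := by linarith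
    rcases le_total (ζ * ‖y 0‖) (∑ i ∈ Finset.range T, |⟪a i, x i⟫|) with hu | hu
    · have hs := mul_sq_le_of_le_sum hζ.le (norm_nonneg _) hT hu
      calc μ * (‖x 0‖ ^ 2 + ‖y 0‖ ^ 2)
          ≤ (9 / 16) * γ * ζ ^ 2 * (1 - lam) / T * (‖x 0‖ ^ 2 + ‖y 0‖ ^ 2) := by gcongr
        _ = γ * (9 / 16 * (ζ ^ 2 * ((1 - lam) * (‖x 0‖ ^ 2 + ‖y 0‖ ^ 2)) / T)) := by ring
        _ ≤ γ * (9 / 16 * (ζ ^ 2 * ‖y 0‖ ^ 2 / T)) := by gcongr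
        _ ≤ γ * (9 / 16 * ∑ i ∈ Finset.range T, |⟪a i, x i⟫| ^ 2
            + 7 / 4 * ∑ i ∈ Finset.range T, ‖z i‖ ^ 2) := by gcongr; linarith
    · have hz : ξ * ‖y 0‖ ≤ ∑ i ∈ Finset.range T, ‖z i‖ := by
        have h1 := h.excitation_right_le hβ0 hβ1 hγ0 hγβ T
        have h2 : (γ * T + γ * β * (1 + T) / (1 - γ * β)) *
            ∑ i ∈ Finset.range T, |⟪a i, x i⟫| ≤
            (γ * T + γ * β * (1 + T) / (1 - γ * β)) * (ζ * ‖y 0‖) := by gcongr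
        rw [hξdef, div_mul_eq_mul_div, div_le_iff₀ (by positivity)]
        have h3 : γ * β * ζ * (1 + T) / (1 - γ * β) =
            ζ * (γ * β * (1 + T) / (1 - γ * β)) := by ring
        rw [h3]
        linarith
      have hs := mul_sq_le_of_le_sum hξ.le (norm_nonneg _) hT hz
      calc μ * (‖x 0‖ ^ 2 + ‖y 0‖ ^ 2)
          ≤ (7 / 4) * ξ ^ 2 * (1 - lam) * γ / T * (‖x 0‖ ^ 2 + ‖y 0‖ ^ 2) := by gcongr
        _ = γ * (7 / 4 * (ξ ^ 2 * ((1 - lam) * (‖x 0‖ ^ 2 + ‖y 0‖ ^ 2)) / T)) := by ring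
        _ ≤ γ * (7 / 4 * (ξ ^ 2 * ‖y 0‖ ^ 2 / T)) := by gcongr
        _ ≤ γ * (9 / 16 * ∑ i ∈ Finset.range T, |⟪a i, x i⟫| ^ 2
            + 7 / 4 * ∑ i ∈ Finset.range T, ‖z i‖ ^ 2) := by gcongr; linarith

end IsTunerError

lemma inner_normalized_smul (φ v : E) (c : ℝ) :
    (c * ⟪(√(1 + ‖φ‖ ^ 2))⁻¹ • φ, v⟫) • ((√(1 + ‖φ‖ ^ 2))⁻¹ • φ) =
      (c / (1 + ‖φ‖ ^ 2) * ⟪φ, v⟫) • φ := by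
  have hN : 0 < 1 + ‖φ‖ ^ 2 := by positivity
  rw [real_inner_smul_left, smul_smul]
  congr 1
  have hinv : (√(1 + ‖φ‖ ^ 2))⁻¹ * (√(1 + ‖φ‖ ^ 2))⁻¹ = (1 + ‖φ‖ ^ 2)⁻¹ := by
    rw [← mul_inv, Real.mul_self_sqrt hN.le]
  linear_combination c * ⟪φ, v⟫ * hinv

lemma norm_normalized_le_one (φ : E) : ‖(√(1 + ‖φ‖ ^ 2))⁻¹ • φ‖ ≤ 1 := by
  have hN : 0 < 1 + ‖φ‖ ^ 2 := by positivity
  rw [norm_smul, norm_inv, Real.norm_eq_abs, abs_of_nonneg (Real.sqrt_nonneg _),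
    inv_mul_le_one₀ (Real.sqrt_pos.2 hN)]
  exact Real.le_sqrt_of_sq_le (by linarith)

/-- The tuner recursions, rewritten for the normalized regressor. -/
lemma isTunerError_of_tuner {β γ : ℝ} {θstar : E} {φ θ ϑ θbar : ℕ → E}
    (hθbar : ∀ k, θbar k =
      θ k - ((γ * β / (1 + ‖φ k‖ ^ 2)) * ⟪φ k, θ k - θstar⟫) • φ k)
    (hθ : ∀ k, θ (k + 1) = θbar k - β • (θbar k - ϑ k))
    (hϑ : ∀ k, ϑ (k + 1) =
      ϑ k - ((γ / (1 + ‖φ k‖ ^ 2)) * ⟪φ k, θ (k + 1) - θstar⟫) • φ k) :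
    IsTunerError β γ (fun k => (√(1 + ‖φ k‖ ^ 2))⁻¹ • φ k) (fun k => ϑ k - θstar)
      (fun k => θ k - ϑ k) (fun k => θbar k - ϑ k) := by
  have hstep : ∀ k, θ (k + 1) - θstar = (ϑ k - θstar) + (1 - β) • (θbar k - ϑ k) := by
    intro k
    rw [hθ]
    module
  have hϑ' : ∀ k, ϑ (k + 1) = ϑ k - (γ * (⟪(√(1 + ‖φ k‖ ^ 2))⁻¹ • φ k, ϑ k - θstar⟫ +
      (1 - β) * ⟪(√(1 + ‖φ k‖ ^ 2))⁻¹ • φ k, θbar k - ϑ k⟫)) •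
        ((√(1 + ‖φ k‖ ^ 2))⁻¹ • φ k) := by
    intro k
    rw [hϑ, ← inner_normalized_smul, hstep, inner_add_right, inner_smul_right]
  refine ⟨fun k => norm_normalized_le_one _, fun k => ?_, fun k => ?_, fun k => ?_⟩
  · rw [add_comm (ϑ k - θstar), sub_add_sub_cancel, inner_normalized_smul, hθbar]
    abel
  · rw [hϑ' k]
    abel
  · rw [hϑ' k, hθ]
    module

/-- Excitation of unit vectors extends to all vectors by homogeneity. -/
lemma sum_abs_inner_ge_of_unit {ι : Type*} {s : Finset ι} {φ : ι → E} {c ε : ℝ} (hc : 0 < c)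
    (h : ∀ w : E, ‖w‖ = 1 → ε ≤ 1 / c * ∑ i ∈ s, |⟪φ i, w⟫|) (v : E) :
    c * ε * ‖v‖ ≤ ∑ i ∈ s, |⟪φ i, v⟫| := by
  rcases eq_or_ne v 0 with rfl | hv
  · simp
  have hv' : 0 < ‖v‖ := norm_pos_iff.2 hv
  have h1 := h (‖v‖⁻¹ • v) (by rw [norm_smul, norm_inv, norm_norm, inv_mul_cancel₀ hv'.ne'])
  simp only [inner_smul_right, abs_mul, abs_of_pos (inv_pos.2 hv'), ← Finset.mul_sum] at h1
  calc c * ε * ‖v‖ ≤ c * (1 / c * (‖v‖⁻¹ * ∑ i ∈ s, |⟪φ i, v⟫|)) * ‖v‖ := by gcongr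
    _ = ∑ i ∈ s, |⟪φ i, v⟫| := by field_simp

end ErrorDynamics

theorem na_exponential_convergence
    (n : ℕ) (hn : 1 ≤ n)
    (θstar : EuclideanSpace ℝ (Fin n))
    (φ θ ϑ θbar : ℕ → EuclideanSpace ℝ (Fin n))
    (β γ : ℝ) (hβ0 : 0 < β) (hβ1 : β < 1)
    (hγ0 : 0 < γ) (hγ : γ ≤ β * (2 - β) / (8 + β ^ 2))
    (hθbar : ∀ k, θbar k =
      θ k - ((γ * β / (1 + ‖φ k‖ ^ 2)) * ⟪φ k, θ k - θstar⟫) • φ k)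
    (hθ : ∀ k, θ (k + 1) = θbar k - β • (θbar k - ϑ k))
    (hϑ : ∀ k, ϑ (k + 1) =
      ϑ k - ((γ / (1 + ‖φ k‖ ^ 2)) * ⟪φ k, θ (k + 1) - θstar⟫) • φ k)
    (V : ℕ → ℝ)
    (hV : ∀ k, V k = (1 / γ) * ‖ϑ k - θstar‖ ^ 2 + (1 / γ) * ‖θ k - ϑ k‖ ^ 2)
    (ΔT : ℕ) (hΔT : 1 ≤ ΔT)
    (ε : ℝ) (hε : 0 < ε)
    (hPE : ∀ m, ΔT ≤ m → ∀ w : EuclideanSpace ℝ (Fin n), ‖w‖ = 1 →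
      ε ≤ (1 / (ΔT : ℝ)) * ∑ i ∈ Finset.Ico (m - ΔT) m, |⟪φ i, w⟫|)
    (Φ : ℝ) (hΦ : ∀ m, ‖φ m‖ ≤ Φ)
    (lam η ζ : ℝ) (hlam0 : 0 < lam) (hlam1 : lam < 1) (hη : 0 < η) (hζ : 0 < ζ)
    (hηε : γ * η * (1 - β) < ε / Real.sqrt (1 + Φ ^ 2))
    (hγβ : γ * β < 1)
    (ξ : ℝ)
    (hξdef : ξ = ((ΔT : ℝ) - γ * ζ * ΔT - γ * β * ζ * (1 + ΔT) / (1 - γ * β)) /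
      (1 + γ * (1 - β) * ΔT + β * ΔT + γ * β * (1 + ΔT) / (1 - γ * β)))
    (hξ : 0 < ξ)
    (μ : ℝ)
    (hμ : μ = min (min (min ((7 / 4) * lam * γ * η ^ 2 / (ΔT : ℝ))
      ((9 / 16) * (ΔT : ℝ) * (ε / Real.sqrt (1 + Φ ^ 2) - γ * η * (1 - β)) ^ 2 *
        lam * γ / (1 + γ * ΔT) ^ 2))
      ((9 / 16) * γ * ζ ^ 2 * (1 - lam) / (ΔT : ℝ)))
      ((7 / 4) * ξ ^ 2 * (1 - lam) * γ / (ΔT : ℝ))) :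
    ∀ k : ℕ, V k ≤ Real.exp (-μ * ((k / ΔT : ℕ) : ℝ)) * V 0 := by
  have hT' : (0 : ℝ) < ΔT := by exact_mod_cast hΔT
  have hγ' : γ * (8 + β ^ 2) ≤ β * (2 - β) := (le_div_iff₀ (by positivity)).1 hγ
  have herr := isTunerError_of_tuner hθbar hθ hϑ
  have hVW : ∀ k, γ * V k = ‖ϑ k - θstar‖ ^ 2 + ‖θ k - ϑ k‖ ^ 2 := by
    intro k
    rw [hV]
    field_simp
  have hV0 : ∀ k, 0 ≤ V k := by
    intro k
    rw [hV]
    positivity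
  have hmono : Antitone V := antitone_nat_of_succ_le fun k => by
    have h := (herr.shift k).sum_decrease hβ0 hβ1 hγ0 hγ' 1
    simp only [add_zero, Finset.sum_range_one] at h
    rw [← hVW, ← hVW] at h
    refine le_of_mul_le_mul_left (le_trans (le_add_of_nonneg_right ?_) h) hγ0
    positivity
  have hPE' : ∀ k, ΔT * (ε / √(1 + Φ ^ 2)) * ‖ϑ k - θstar‖ ≤
      ∑ i ∈ Finset.range ΔT, |⟪(√(1 + ‖φ (k + i)‖ ^ 2))⁻¹ • φ (k + i), ϑ k - θstar⟫| := by
    intro k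
    have hR : 0 < √(1 + Φ ^ 2) := Real.sqrt_pos.2 (by positivity)
    have h1 := sum_abs_inner_ge_of_unit hT' (hPE (k + ΔT) (Nat.le_add_left _ _)) (ϑ k - θstar)
    rw [Nat.add_sub_cancel, Finset.sum_Ico_eq_sum_range, Nat.add_sub_cancel_left] at h1
    calc ΔT * (ε / √(1 + Φ ^ 2)) * ‖ϑ k - θstar‖
        = (√(1 + Φ ^ 2))⁻¹ * (ΔT * ε * ‖ϑ k - θstar‖) := by ring
      _ ≤ (√(1 + Φ ^ 2))⁻¹ * ∑ i ∈ Finset.range ΔT, |⟪φ (k + i), ϑ k - θstar⟫| := by gcongr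
      _ ≤ _ := by
        rw [Finset.mul_sum]
        refine Finset.sum_le_sum fun i _ => ?_
        rw [real_inner_smul_left, abs_mul, abs_of_pos (inv_pos.2 (Real.sqrt_pos.2 (by positivity)))]
        have := hΦ (k + i)
        gcongr
  have hwin : ∀ k, V (k + ΔT) ≤ Real.exp (-μ) * V k := by
    intro k
    have hμ₁ := hμ.le.trans ((min_le_left _ _).trans ((min_le_left _ _).trans (min_le_left _ _)))
    have hμ₂ := hμ.le.trans ((min_le_left _ _).trans ((min_le_left _ _).trans (min_le_right _ _)))
    have hμ₃ := hμ.le.trans ((min_le_left _ _).trans (min_le_right _ _))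
    have hμ₄ := hμ.le.trans (min_le_right _ _)
    have h := (herr.shift k).window_contraction hβ0 hβ1 hγ0 hγ' hγβ hΔT (hPE' k) hlam0 hlam1
      hη hζ hηε hξdef hξ hμ₁ hμ₂ hμ₃ hμ₄
    simp only [add_zero] at h
    rw [← hVW, ← hVW, mul_left_comm] at h
    refine (le_of_mul_le_mul_left h hγ0).trans ?_
    exact mul_le_mul_of_nonneg_right (Real.one_sub_le_exp_neg μ) (hV0 k)
  have hmul : ∀ j : ℕ, V (ΔT * j) ≤ Real.exp (-μ * j) * V 0 := by
    intro j
    induction j with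
    | zero => simp
    | succ j ih =>
      calc V (ΔT * (j + 1)) ≤ Real.exp (-μ) * V (ΔT * j) := hwin _
        _ ≤ Real.exp (-μ) * (Real.exp (-μ * j) * V 0) := by gcongr
        _ = Real.exp (-μ * (j + 1 : ℕ)) * V 0 := by
          rw [← mul_assoc, ← Real.exp_add]
          push_cast
          ring_nf
  exact fun k => (hmono (Nat.mul_div_le k ΔT)).trans (hmul _)
end
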